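/- For every integer n ≥ 1, the number of Dyck paths of length 2(n+1) whose partial sum after the first 2·⌊(n+1)/2⌋ steps equals 0 (i.e. double-Dyck paths, Dyck paths through the point (2⌊(n+1)/2⌋, 0)) equals C_{⌊(n+1)/2⌋} · C_{⌈(n+1)/2⌉}, where C_m is the m-th Catalan number. -/

import Mathlib

open Finset

/-- The value of a Dyck-path step: `true` is an up-step (+1), `false` a down-step (-1). -/
def stepVal (b : Bool) : ℤ := if b then 1 else -1

/-- Partial sum of the first `k` steps of a ±1 path of length `m`. -/
def partialSum {m : ℕ} (p : Fin m → Bool) (k : ℕ) : ℤ :=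
  ∑ i ∈ Finset.univ.filter (fun i : Fin m => (i : ℕ) < k), stepVal (p i)

/-- A Dyck path: total sum 0 and all partial sums nonnegative. -/
def IsDyckPath {m : ℕ} (p : Fin m → Bool) : Prop :=
  partialSum p m = 0 ∧ ∀ k ≤ m, 0 ≤ partialSum p k

open Classical in
/-- The finset of Dyck paths of length `m`. -/
noncomputable def dyckPaths (m : ℕ) : Finset (Fin m → Bool) :=
  Finset.univ.filter (fun p => IsDyckPath p)

/-- Number of humps (an up-step immediately followed by a down-step) of a path. -/
def humps {m : ℕ} (p : Fin m → Bool) : ℕ :=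
  (Finset.univ.filter (fun i : Fin (m - 1) =>
    p ⟨(i : ℕ), by have := i.isLt; omega⟩ = true ∧
    p ⟨(i : ℕ) + 1, by have := i.isLt; omega⟩ = false)).card

/-- `HC n`: the total number of humps over all Dyck paths of length `2n`. -/
noncomputable def HC (n : ℕ) : ℕ := ∑ p ∈ dyckPaths (2 * n), humps p

open Classical in
/-- Double-Dyck paths: Dyck paths of length `2(n+1)` passing through `(2⌊(n+1)/2⌋, 0)`. -/
noncomputable def doubleDyckPaths (n : ℕ) : Finset (Fin (2 * (n + 1)) → Bool) :=
  (dyckPaths (2 * (n + 1))).filter (fun p => partialSum p (2 * ((n + 1) / 2)) = 0)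

theorem partialSum_eq_sum_ite {m : ℕ} (p : Fin m → Bool) (k : ℕ) :
    partialSum p k = ∑ i : Fin m, if (i : ℕ) < k then stepVal (p i) else 0 := by
  rw [partialSum, Finset.sum_filter]

@[simp]
theorem partialSum_zero {m : ℕ} (p : Fin m → Bool) : partialSum p 0 = 0 := by
  simp [partialSum]

theorem partialSum_of_le {m : ℕ} (p : Fin m → Bool) {k : ℕ} (hk : m ≤ k) :
    partialSum p k = partialSum p m := by
  simp only [partialSum_eq_sum_ite]
  refine Finset.sum_congr rfl fun i _ => ?_
  rw [if_pos i.isLt, if_pos (i.isLt.trans_le hk)]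

theorem partialSum_succ {m : ℕ} (p : Fin m → Bool) (k : Fin m) :
    partialSum p (k + 1) = partialSum p k + stepVal (p k) := by
  have h : univ.filter (fun i : Fin m => (i : ℕ) < k + 1) =
      insert k (univ.filter fun i : Fin m => (i : ℕ) < k) := by
    ext i
    simp only [mem_filter, mem_univ, true_and, mem_insert, Fin.ext_iff]
    omega
  rw [partialSum, h, Finset.sum_insert (by simp), add_comm, partialSum]

theorem partialSum_append {a b : ℕ} (p : Fin a → Bool) (q : Fin b → Bool) (k : ℕ) :
    partialSum (Fin.append p q) k = partialSum p k + partialSum q (k - a) := by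
  simp only [partialSum_eq_sum_ite, Fin.sum_univ_add, Fin.append_left, Fin.append_right,
    Fin.val_castAdd, Fin.val_natAdd, Nat.lt_sub_iff_add_lt']

theorem isDyckPath_append_iff {a b : ℕ} (p : Fin a → Bool) (q : Fin b → Bool) :
    IsDyckPath (Fin.append p q) ∧ partialSum (Fin.append p q) a = 0 ↔
      IsDyckPath p ∧ IsDyckPath q := by
  simp only [IsDyckPath, partialSum_append, Nat.sub_self, partialSum_zero, add_zero,
    Nat.add_sub_cancel_left, partialSum_of_le p (Nat.le_add_right a b)]
  constructor
  · rintro ⟨⟨hsum, hnonneg⟩, hp⟩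
    refine ⟨⟨hp, fun k hk => ?_⟩, by omega, fun k hk => ?_⟩
    · simpa [Nat.sub_eq_zero_of_le hk] using hnonneg k (by omega)
    · simpa [partialSum_of_le p (Nat.le_add_right a k), hp] using hnonneg (a + k) (by omega)
  · rintro ⟨⟨hp, hp'⟩, hq, hq'⟩
    refine ⟨⟨by omega, fun k hk => add_nonneg ?_ (hq' _ (by omega))⟩, hp⟩
    rcases le_total k a with h | h
    · exact hp' k h
    · rw [partialSum_of_le p h, hp]

open Classical in
theorem card_dyckPaths_filter_partialSum_eq_zero {m a b : ℕ} (hm : m = a + b) :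
    ((dyckPaths m).filter fun p => partialSum p a = 0).card =
      (dyckPaths a).card * (dyckPaths b).card := by
  subst hm
  rw [← Finset.card_product]
  refine (Finset.card_equiv (Fin.appendEquiv a b) fun pq => ?_).symm
  simpa [dyckPaths, Fin.appendEquiv] using (isDyckPath_append_iff pq.1 pq.2).symm

/-- The list of steps of a path. -/
def dyckSteps {m : ℕ} (p : Fin m → Bool) : List DyckStep :=
  List.ofFn fun i => if p i then .U else .D

@[simp]
theorem length_dyckSteps {m : ℕ} (p : Fin m → Bool) : (dyckSteps p).length = m := by
  simp [dyckSteps]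

theorem dyckSteps_injective {m : ℕ} :
    Function.Injective (dyckSteps : (Fin m → Bool) → List DyckStep) := by
  intro p q h
  funext i
  have := congrFun (List.ofFn_injective h) i
  revert this
  cases p i <;> cases q i <;> simp

theorem exists_dyckSteps_eq {m : ℕ} (l : List DyckStep) (hl : l.length = m) :
    ∃ p : Fin m → Bool, dyckSteps p = l := by
  subst hl
  refine ⟨fun i => l.get i = .U, ?_⟩
  refine List.ext_get (by simp) fun i _ h => ?_
  rcases (l[i]).dichotomy with h' | h' <;> simp [dyckSteps, h']

theorem partialSum_eq_count_sub_count {m : ℕ} (p : Fin m → Bool) (k : ℕ) (hk : k ≤ m) :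
    partialSum p k =
      ((dyckSteps p).take k).count .U - ((dyckSteps p).take k).count .D := by
  induction k with
  | zero => simp
  | succ k ih =>
    rw [partialSum_succ p ⟨k, hk⟩, ih (by omega),
      List.take_succ_eq_append_getElem (by simpa using hk)]
    cases h : p ⟨k, hk⟩ <;> simp [dyckSteps, stepVal, h] <;> ring

theorem isDyckPath_iff_count {m : ℕ} (p : Fin m → Bool) :
    IsDyckPath p ↔ (dyckSteps p).count .U = (dyckSteps p).count .D ∧
      ∀ k, ((dyckSteps p).take k).count .D ≤ ((dyckSteps p).take k).count .U := by
  have htake {k : ℕ} (hk : m ≤ k) : (dyckSteps p).take k = dyckSteps p :=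
    List.take_of_length_le (by simpa using hk)
  rw [IsDyckPath, partialSum_eq_count_sub_count p m le_rfl, htake le_rfl]
  constructor
  · rintro ⟨hsum, hnonneg⟩
    refine ⟨by omega, fun k => ?_⟩
    rcases le_total k m with hk | hk
    · have := hnonneg k hk
      rw [partialSum_eq_count_sub_count p k hk] at this
      omega
    · rw [htake hk]
      omega
  · rintro ⟨hsum, hle⟩
    refine ⟨by omega, fun k hk => ?_⟩
    have := hle k
    rw [partialSum_eq_count_sub_count p k hk]
    omega

/-- The Dyck word of a Dyck path. -/
def IsDyckPath.toDyckWord {m : ℕ} {p : Fin m → Bool} (hp : IsDyckPath p) : DyckWord where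
  toList := dyckSteps p
  count_U_eq_count_D := ((isDyckPath_iff_count p).1 hp).1
  count_D_le_count_U := ((isDyckPath_iff_count p).1 hp).2

theorem IsDyckPath.semilength_toDyckWord {n : ℕ} {p : Fin (2 * n) → Bool} (hp : IsDyckPath p) :
    hp.toDyckWord.semilength = n := by
  have := hp.toDyckWord.two_mul_semilength_eq_length
  simp only [toDyckWord, length_dyckSteps] at this ⊢
  omega

theorem card_dyckPaths_two_mul (n : ℕ) : (dyckPaths (2 * n)).card = catalan n := by
  rw [← DyckWord.card_dyckWord_semilength_eq_catalan, ← Finset.card_univ]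
  have hmem {p : Fin (2 * n) → Bool} : p ∈ dyckPaths (2 * n) ↔ IsDyckPath p := by
    simp [dyckPaths]
  refine Finset.card_bij
    (fun p hp => ⟨(hmem.1 hp).toDyckWord, (hmem.1 hp).semilength_toDyckWord⟩)
    (fun _ _ => mem_univ _) (fun p _ q _ h => ?_) fun ⟨w, hw⟩ _ => ?_
  · exact dyckSteps_injective (congrArg (fun w => w.1.toList) h)
  · obtain ⟨p, hp⟩ := exists_dyckSteps_eq (m := 2 * n) w.toList
      (by rw [← w.two_mul_semilength_eq_length, hw])
    have hdyck : IsDyckPath p := by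
      rw [isDyckPath_iff_count, hp]
      exact ⟨w.count_U_eq_count_D, w.count_D_le_count_U⟩
    exact ⟨p, hmem.2 hdyck, Subtype.ext (DyckWord.ext hp)⟩

/-- The number of double-Dyck paths of length `2(n+1)` equals
`C_{⌊(n+1)/2⌋} · C_{⌈(n+1)/2⌉}`. -/
theorem double_dyck_count (n : ℕ) (hn : 1 ≤ n) :
    (doubleDyckPaths n).card = catalan ((n + 1) / 2) * catalan ((n + 2) / 2) := by
  rw [doubleDyckPaths, card_dyckPaths_filter_partialSum_eq_zero
    (show 2 * (n + 1) = 2 * ((n + 1) / 2) + 2 * ((n + 2) / 2) by omega),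
    card_dyckPaths_two_mul, card_dyckPaths_two_mul]
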